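/- For all positive integers n and s, n^s = Σ_{d | n} Φ_s(d^s), where the sum is over positive divisors d of n; equivalently, n^s equals the sum of Φ_s(d^s) over all positive integers d with d^s | n^s. -/

import Mathlib

open scoped Classical

/-- The generalized gcd `(a, b)_s`: the largest positive integer of the form `l ^ s`
(`l ∈ ℕ`) dividing both `a` and `b`. -/
noncomputable def sgcd (s : ℕ) (a b : ℤ) : ℕ :=
  sSup {m : ℕ | 0 < m ∧ (∃ l : ℕ, m = l ^ s) ∧ (m : ℤ) ∣ a ∧ (m : ℤ) ∣ b}

/-- Klee's function `Φ_s(n)`: the number of `m` with `1 ≤ m ≤ n` and `(m, n)_s = 1`. -/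
noncomputable def klee (s n : ℕ) : ℕ :=
  ((Finset.Icc 1 n).filter (fun m => sgcd s (m : ℤ) (n : ℤ) = 1)).card

theorem exists_pow_dvd_divisor_maximal {n s : ℕ} (hn : n ≠ 0) (m : ℕ) :
    ∃ g, g ∣ n ∧ g ^ s ∣ m ∧ ∀ l, l ∣ n → l ^ s ∣ m → l ∣ g := by
  have h₁ : 1 ≤ n := Nat.one_le_iff_ne_zero.mpr hn
  obtain ⟨hg, hgm⟩ : Nat.findGreatest (fun l => l ∣ n ∧ l ^ s ∣ m) n ∣ n ∧
      Nat.findGreatest (fun l => l ∣ n ∧ l ^ s ∣ m) n ^ s ∣ m :=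
    Nat.findGreatest_spec (P := fun l => l ∣ n ∧ l ^ s ∣ m) h₁ (by simp)
  refine ⟨_, hg, hgm, fun l hl hlm => ?_⟩
  set g := Nat.findGreatest (fun l => l ∣ n ∧ l ^ s ∣ m) n
  have hL : Nat.lcm l g ∣ n := Nat.lcm_dvd hl hg
  have hLm : Nat.lcm l g ^ s ∣ m := by
    rw [← Nat.pow_lcm_pow]
    exact Nat.lcm_dvd hlm hgm
  have hle : Nat.lcm l g ≤ g :=
    Nat.le_findGreatest (Nat.le_of_dvd h₁ hL) ⟨hL, hLm⟩
  have hg0 : 0 < g := Nat.pos_of_dvd_of_pos hg h₁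
  have heq : Nat.lcm l g = g :=
    le_antisymm hle (Nat.le_of_dvd (Nat.pos_of_dvd_of_pos hL h₁) (Nat.dvd_lcm_right l g))
  rw [← heq]
  exact Nat.dvd_lcm_left l g

theorem sgcd_pow_eq_one_iff {s d : ℕ} (hs : s ≠ 0) (hd : d ≠ 0) (k : ℕ) :
    sgcd s (k : ℤ) ((d ^ s : ℕ) : ℤ) = 1 ↔ ∀ l, l ∣ d → l ^ s ∣ k → l = 1 := by
  unfold sgcd
  simp only [Int.natCast_dvd_natCast]
  set S : Set ℕ := {m | 0 < m ∧ (∃ l : ℕ, m = l ^ s) ∧ m ∣ k ∧ m ∣ d ^ s}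
  have hbdd : BddAbove S := ⟨d ^ s, fun m hm => Nat.le_of_dvd (by positivity) hm.2.2.2⟩
  have hone : 1 ∈ S := ⟨one_pos, ⟨1, (one_pow s).symm⟩, one_dvd _, one_dvd _⟩
  constructor
  · intro h l hl hlk
    have hl0 : 0 < l := Nat.pos_of_dvd_of_pos hl (Nat.pos_of_ne_zero hd)
    have hle : l ^ s ≤ 1 := h ▸ le_csSup hbdd ⟨by positivity, ⟨l, rfl⟩, hlk, pow_dvd_pow_of_dvd hl s⟩
    exact (Nat.pow_eq_one.mp (le_antisymm hle (Nat.one_le_pow _ _ hl0))).resolve_right hs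
  · intro h
    refine le_antisymm (csSup_le ⟨1, hone⟩ ?_) (le_csSup hbdd hone)
    rintro _ ⟨-, ⟨l, rfl⟩, hlk, hld⟩
    rw [h l ((Nat.pow_dvd_pow_iff hs).mp hld) hlk, one_pow]

theorem klee_eq_card_filter (s n : ℕ) :
    klee s n = ((Finset.Icc 1 n).filter (fun m : ℕ => sgcd s (m : ℤ) (n : ℤ) = 1)).card := by
  unfold klee
  symm
  refine Finset.card_bij (fun m _ => (m : ℤ)) ?_ ?_ ?_
  · intro m hm
    simp only [Finset.mem_filter, Finset.bind_def, Finset.pure_def, Finset.mem_sup,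
      Finset.mem_singleton] at hm ⊢
    exact ⟨⟨m, hm.1, rfl⟩, hm.2⟩
  · intro a _ b _ h
    exact Int.ofNat_inj.mp h
  · intro z hz
    simp only [Finset.mem_filter, Finset.bind_def, Finset.pure_def, Finset.mem_sup,
      Finset.mem_singleton] at hz
    obtain ⟨⟨m, hm, rfl⟩, h⟩ := hz
    exact ⟨m, Finset.mem_filter.mpr ⟨hm, h⟩, rfl⟩

theorem pow_eq_sum_klee_divisors {n s : ℕ} (hn : n ≠ 0) (hs : s ≠ 0) :
    n ^ s = ∑ d ∈ n.divisors, klee s (d ^ s) := by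
  choose g hgn hgm hmax using fun m => exists_pow_dvd_divisor_maximal (s := s) hn m
  have hcard : n ^ s = ∑ e ∈ n.divisors, ((Finset.Icc 1 (n ^ s)).filter (fun m => g m = e)).card := by
    rw [← Finset.card_eq_sum_card_fiberwise
      (fun m _ => Finset.mem_coe.mpr (Nat.mem_divisors.mpr ⟨hgn m, hn⟩))]
    simp
  rw [hcard, ← Nat.sum_div_divisors n (fun d => klee s (d ^ s))]
  refine Finset.sum_congr rfl fun e he => ?_
  obtain ⟨d, rfl⟩ := Nat.dvd_of_mem_divisors he
  obtain ⟨he0, hd0⟩ := mul_ne_zero_iff.mp hn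
  rw [Nat.mul_div_cancel_left d (Nat.pos_of_ne_zero he0)]
  have hes : 0 < e ^ s := by positivity
  rw [klee_eq_card_filter]
  symm
  refine Finset.card_bij (fun k _ => e ^ s * k) ?_ ?_ ?_
  · intro k hk
    rw [Finset.mem_filter, Finset.mem_Icc, sgcd_pow_eq_one_iff hs hd0] at hk
    obtain ⟨⟨hk1, hkd⟩, hk⟩ := hk
    rw [Finset.mem_filter, Finset.mem_Icc, mul_pow]
    refine ⟨⟨Nat.mul_pos hes hk1, Nat.mul_le_mul_left _ hkd⟩, ?_⟩
    obtain ⟨t, ht⟩ := hmax (e ^ s * k) e (dvd_mul_right e d) (dvd_mul_right _ k)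
    have h₁ := hgn (e ^ s * k)
    have h₂ := hgm (e ^ s * k)
    rw [ht] at h₁ h₂
    rw [mul_pow] at h₂
    rw [ht, hk t (Nat.dvd_of_mul_dvd_mul_left (Nat.pos_of_ne_zero he0) h₁)
      (Nat.dvd_of_mul_dvd_mul_left hes h₂), mul_one]
  · intro a _ b _ h
    exact Nat.eq_of_mul_eq_mul_left hes h
  · intro m hm
    rw [Finset.mem_filter, Finset.mem_Icc, mul_pow] at hm
    obtain ⟨⟨hm1, hmn⟩, rfl⟩ := hm
    obtain ⟨k, hk⟩ := hgm m
    refine ⟨k, ?_, hk.symm⟩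
    rw [Finset.mem_filter, Finset.mem_Icc, sgcd_pow_eq_one_iff hs hd0]
    refine ⟨⟨Nat.pos_of_ne_zero ?_, Nat.le_of_mul_le_mul_left (hk ▸ hmn) hes⟩, ?_⟩
    · rintro rfl
      omega
    · intro l hl hlk
      have h := hmax m (g m * l) (mul_dvd_mul_left _ hl) (by
        rw [mul_pow]
        exact (mul_dvd_mul_left _ hlk).trans hk.symm.dvd)
      exact Nat.dvd_one.mp
        (Nat.dvd_of_mul_dvd_mul_left (Nat.pos_of_ne_zero he0) (by rwa [mul_one]))

theorem sum_klee_divisors (n s : ℕ) (hn : 0 < n) (hs : 0 < s) :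
    n ^ s = ∑ d ∈ n.divisors, klee s (d ^ s) ∧
    n ^ s = ∑ d ∈ (n ^ s).divisors.filter (fun d => d ^ s ∣ n ^ s), klee s (d ^ s) := by
  have h := pow_eq_sum_klee_divisors hn.ne' hs.ne'
  have hfilter : (n ^ s).divisors.filter (fun d => d ^ s ∣ n ^ s) = n.divisors := by
    ext d
    simp only [Finset.mem_filter, Nat.mem_divisors, Nat.pow_dvd_pow_iff hs.ne']
    exact ⟨fun hd => ⟨hd.2, hn.ne'⟩,
      fun hd => ⟨⟨hd.1.trans (dvd_pow_self n hs.ne'), pow_ne_zero s hn.ne'⟩, hd.1⟩⟩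
  exact ⟨h, hfilter ▸ h⟩
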